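/- arXiv:2308.11399 — 5 statements merged into one kernel-verified Lean document; each statement's English description precedes it below -/
import Mathlib

section
/- Let ℐ be a nonempty finite set and let (p_i)_{i∈ℐ} and (q_i)_{i∈ℐ} be probability vectors such that q_i = 0 implies p_i = 0. Then the Kullback–Leibler divergence satisfies D_KL((p_i) ‖ (q_i)) ≥ ∑_{i∈ℐ} (p_i − q_i)²/(2·max{p_i, q_i}) ≥ (1/2)·∑_{i∈ℐ} (p_i − q_i)², where D_KL((p_i) ‖ (q_i)) = −∑_{i∈ℐ} p_i·log(q_i/p_i), terms with p_i = 0 are taken to be 0, and in the middle sum terms with max{p_i,q_i} = 0 are taken to be 0. -/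
/-- For `0 < t ≤ 1`, the logarithm is bounded above by its second Taylor polynomial at `1`. -/
theorem Real.log_le_sub_one_sub_sq_div_two {t : ℝ} (ht0 : 0 < t) (ht1 : t ≤ 1) :
    Real.log t ≤ t - 1 - (1 - t) ^ 2 / 2 := by
  have hs := Real.hasSum_pow_div_log_of_abs_lt_one (x := 1 - t)
    (by rw [abs_of_nonneg] <;> linarith)
  have h := sum_le_hasSum (Finset.range 2)
    (fun n _ => div_nonneg (pow_nonneg (sub_nonneg.2 ht1) _) (by positivity)) hs
  norm_num [Finset.sum_range_succ] at h
  linarith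

/-- For `0 < s ≤ 1`, `log s ≥ (s - s⁻¹) / 2`. -/
theorem Real.sub_inv_div_two_le_log {s : ℝ} (hs0 : 0 < s) (hs1 : s ≤ 1) :
    (s - s⁻¹) / 2 ≤ Real.log s := by
  rw [← Real.sinh_log hs0]
  exact Real.sinh_le_self_iff.2 (Real.log_nonpos hs0.le hs1)

/-- Pointwise lower bound for the integrand `a log (a / b) - a + b` of the Kullback–Leibler
divergence. -/
theorem sq_sub_div_two_mul_max_le {a b : ℝ} (ha : 0 ≤ a) (hb : 0 ≤ b) (hab : b = 0 → a = 0) :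
    (a - b) ^ 2 / (2 * max a b) ≤ -(a * Real.log (b / a)) - a + b := by
  rcases ha.eq_or_lt with rfl | ha
  · rcases hb.eq_or_lt with rfl | hb
    · simp
    · rw [max_eq_right hb.le, div_le_iff₀ (by positivity)]
      nlinarith
  have hb : 0 < b := hb.lt_of_ne fun h => ha.ne' (hab h.symm)
  rcases le_total b a with h | h
  · have key := mul_le_mul_of_nonneg_left
      (Real.log_le_sub_one_sub_sq_div_two (div_pos hb ha) ((div_le_one ha).2 h)) ha.le
    have e : a * (b / a - 1 - (1 - b / a) ^ 2 / 2) = b - a - (a - b) ^ 2 / (2 * a) := by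
      field_simp
    rw [max_eq_left h]
    linarith
  · have key := mul_le_mul_of_nonneg_left
      (Real.sub_inv_div_two_le_log (div_pos ha hb) ((div_le_one hb).2 h)) ha.le
    have e : a * ((a / b - (a / b)⁻¹) / 2) = a - b + (a - b) ^ 2 / (2 * b) := by
      field_simp
      ring
    rw [max_eq_right h, ← inv_div a b, Real.log_inv]
    linarith

/-- **Quantitative Gibbs' inequality.** For probability vectors `p, q` with `q i = 0 → p i = 0`,
`D_KL(p‖q) ≥ ∑ (p i − q i)²/(2 max{p i, q i}) ≥ (1/2) ∑ (p i − q i)²`, where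
`D_KL(p‖q) = −∑ p i log (q i / p i)` (division by zero is zero by convention). -/
theorem gibbs_inequality_quantitative {ι : Type*} [Fintype ι] [Nonempty ι]
    (p q : ι → ℝ) (hp0 : ∀ i, 0 ≤ p i) (hq0 : ∀ i, 0 ≤ q i)
    (hp1 : ∑ i, p i = 1) (hq1 : ∑ i, q i = 1)
    (habs : ∀ i, q i = 0 → p i = 0) :
    (∑ i, (p i - q i) ^ 2 / (2 * max (p i) (q i)) ≤ -∑ i, p i * Real.log (q i / p i)) ∧
    ((1 / 2) * ∑ i, (p i - q i) ^ 2 ≤ ∑ i, (p i - q i) ^ 2 / (2 * max (p i) (q i))) := by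
  constructor
  · calc ∑ i, (p i - q i) ^ 2 / (2 * max (p i) (q i))
        ≤ ∑ i, (-(p i * Real.log (q i / p i)) - p i + q i) :=
          Finset.sum_le_sum fun i _ => sq_sub_div_two_mul_max_le (hp0 i) (hq0 i) (habs i)
      _ = -∑ i, p i * Real.log (q i / p i) := by
          rw [Finset.sum_add_distrib, Finset.sum_sub_distrib, Finset.sum_neg_distrib, hp1, hq1]
          ring
  · rw [Finset.mul_sum]
    refine Finset.sum_le_sum fun i _ => ?_
    have hpi : p i ≤ 1 := hp1 ▸ Finset.single_le_sum (fun j _ => hp0 j) (Finset.mem_univ i)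
    have hqi : q i ≤ 1 := hq1 ▸ Finset.single_le_sum (fun j _ => hq0 j) (Finset.mem_univ i)
    rcases (le_max_of_le_left (hp0 i) : 0 ≤ max (p i) (q i)).eq_or_lt with h | h
    · have hp : p i = 0 := le_antisymm (h ▸ le_max_left _ _) (hp0 i)
      have hq : q i = 0 := le_antisymm (h ▸ le_max_right _ _) (hq0 i)
      simp [hp, hq]
    · rw [le_div_iff₀ (by positivity)]
      nlinarith [mul_le_mul_of_nonneg_left (max_le hpi hqi) (sq_nonneg (p i - q i))]
end

section
/- For every real number x < 1, one has −log(1−x) ≥ x + x²/(2·max{1, 1−x}), where log is the natural logarithm. -/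
/-- The elementary inequality `−log(1−x) ≥ x + x²/(2 max{1, 1−x})` for all `x < 1`. -/
theorem neg_log_one_sub_ge (x : ℝ) (hx : x < 1) :
    x + x ^ 2 / (2 * max 1 (1 - x)) ≤ -Real.log (1 - x) := by
  have ht : 0 < 1 - x := by linarith
  rcases le_total 0 x with h0 | h0
  · rw [max_eq_left (by linarith)]
    have hs := Real.hasSum_pow_div_log_of_abs_lt_one (abs_lt.2 ⟨by linarith, hx⟩)
    have h := sum_le_hasSum (Finset.range 2) (fun i _ => by positivity) hs
    norm_num [Finset.sum_range_succ] at h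
    linarith
  · rw [max_eq_right (by linarith)]
    have h := Real.self_le_sinh_iff.2 (Real.log_nonneg (by linarith : 1 ≤ 1 - x))
    rw [Real.sinh_log ht] at h
    have e : x + x ^ 2 / (2 * (1 - x)) = -(((1 - x) - (1 - x)⁻¹) / 2) := by
      field_simp
      ring
    rw [e]
    exact neg_le_neg h
end

section
/- Equip ℝ^d with the maximum metric. Let μ and ν be Borel probability measures on ℝ^d and let ℓ ∈ ℕ. If ∑_{I∈D_ℓ} |μ(I) − ν(I)| ≤ 2^{−ℓ}, then d_LP(μ, ν) ≤ 2^{−ℓ}. -/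
open MeasureTheory Set

noncomputable section

/-- The half-open dyadic cube of side length `2^{-n}` in `ℝ^d` (with the maximum metric)
indexed by `k ∈ ℤ^d`. -/
def dyadicCube {d : ℕ} (n : ℕ) (k : Fin d → ℤ) : Set (Fin d → ℝ) :=
  {x | ∀ j, (k j : ℝ) ≤ x j * 2 ^ n ∧ x j * 2 ^ n < (k j : ℝ) + 1}

lemma measurableSet_dyadicCube {d : ℕ} (n : ℕ) (k : Fin d → ℤ) :
    MeasurableSet (dyadicCube n k) := by
  have h : dyadicCube n k =
      ⋂ j, {x | (k j : ℝ) ≤ x j * 2 ^ n} ∩ {x | x j * 2 ^ n < (k j : ℝ) + 1} := by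
    ext x
    simp [dyadicCube]
  rw [h]
  exact MeasurableSet.iInter fun j => (measurableSet_le (by fun_prop) (by fun_prop)).inter
    (measurableSet_lt (by fun_prop) (by fun_prop))

lemma mem_dyadicCube_iff {d : ℕ} {n : ℕ} {k : Fin d → ℤ} {x : Fin d → ℝ} :
    x ∈ dyadicCube n k ↔ (fun j => ⌊x j * 2 ^ n⌋) = k := by
  simp [dyadicCube, funext_iff, Int.floor_eq_iff]

lemma pairwise_disjoint_dyadicCube {d : ℕ} (n : ℕ) :
    Pairwise (Function.onFun Disjoint (dyadicCube (d := d) n)) := by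
  intro k l hkl
  refine Set.disjoint_left.2 fun x hk hl => hkl ?_
  rw [← mem_dyadicCube_iff.1 hk, ← mem_dyadicCube_iff.1 hl]

lemma dist_le_of_mem_dyadicCube {d : ℕ} {n : ℕ} {k : Fin d → ℤ} {x y : Fin d → ℝ}
    (hx : x ∈ dyadicCube n k) (hy : y ∈ dyadicCube n k) : dist x y ≤ ((2:ℝ) ^ n)⁻¹ := by
  refine (dist_pi_le_iff (by positivity)).2 fun j => ?_
  have hx := hx j
  have hy := hy j
  have h2 : (0:ℝ) < 2 ^ n := by positivity
  rw [Real.dist_eq, ← one_div, le_div_iff₀ h2]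
  nth_rw 1 [← abs_of_pos h2]
  rw [← abs_mul, abs_le]
  constructor <;> linarith

lemma summable_measure_dyadicCube {d : ℕ} (n : ℕ) (μ : Measure (Fin d → ℝ)) [IsFiniteMeasure μ] :
    Summable fun k : Fin d → ℤ => (μ (dyadicCube n k)).toReal := by
  apply ENNReal.summable_toReal
  rw [← measure_iUnion (pairwise_disjoint_dyadicCube n) (measurableSet_dyadicCube n)]
  exact measure_ne_top μ _

/-- On a union of dyadic cubes, two finite measures differ by at most their total variation
distance over the dyadic cubes. -/
lemma measure_biUnion_dyadicCube_le {d : ℕ} (n : ℕ) (μ ν : Measure (Fin d → ℝ))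
    [IsFiniteMeasure μ] [IsFiniteMeasure ν] (S : Set (Fin d → ℤ)) :
    μ (⋃ k ∈ S, dyadicCube n k) ≤ ν (⋃ k ∈ S, dyadicCube n k) + ENNReal.ofReal
      (∑' k, |(μ (dyadicCube n k)).toReal - (ν (dyadicCube n k)).toReal|) := by
  have hd : S.PairwiseDisjoint (dyadicCube n) :=
    (pairwise_disjoint_dyadicCube n).set_pairwise S
  have hm : ∀ k ∈ S, MeasurableSet (dyadicCube n k) :=
    fun k _ => measurableSet_dyadicCube n k
  rw [measure_biUnion S.to_countable hd hm, measure_biUnion S.to_countable hd hm,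
    ENNReal.ofReal_tsum_of_nonneg (fun _ => abs_nonneg _)
      ((summable_measure_dyadicCube n μ).sub (summable_measure_dyadicCube n ν)).abs]
  refine le_trans ?_ (add_le_add le_rfl (ENNReal.tsum_comp_le_tsum_of_injective
    (Subtype.val_injective (p := (· ∈ S))) _))
  rw [← ENNReal.tsum_add]
  refine ENNReal.tsum_le_tsum fun k => ?_
  rw [← ENNReal.ofReal_toReal (measure_ne_top μ (dyadicCube n k)),
    ← ENNReal.ofReal_toReal (measure_ne_top ν (dyadicCube n k)),
    ENNReal.toReal_ofReal ENNReal.toReal_nonneg, ENNReal.toReal_ofReal ENNReal.toReal_nonneg,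
    ← ENNReal.ofReal_add ENNReal.toReal_nonneg (abs_nonneg _)]
  apply ENNReal.ofReal_le_ofReal
  linarith [le_abs_self ((μ (dyadicCube n k)).toReal - (ν (dyadicCube n k)).toReal)]

/-- **Inequality (2.2).** If the total variation distance of `μ` and `ν` over the dyadic cubes
of generation `ℓ` is at most `2^{-ℓ}`, then `d_LP(μ, ν) ≤ 2^{-ℓ}`, where `d_LP` is the
Lévy–Prokhorov distance with respect to the maximum metric on `ℝ^d`. -/
theorem levyProkhorov_le_of_dyadic_tv {d : ℕ} (μ ν : Measure (Fin d → ℝ))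
    [IsProbabilityMeasure μ] [IsProbabilityMeasure ν] (ℓ : ℕ)
    (h : ∑' k : Fin d → ℤ,
        |(μ (dyadicCube ℓ k)).toReal - (ν (dyadicCube ℓ k)).toReal| ≤ ((2:ℝ) ^ ℓ)⁻¹) :
    levyProkhorovEDist μ ν ≤ ENNReal.ofReal ((2:ℝ) ^ ℓ)⁻¹ := by
  refine levyProkhorovEDist_le_of_forall_le μ ν _ fun ε B hε hε_top _ => ?_
  let S : Set (Fin d → ℤ) := {k | (dyadicCube ℓ k ∩ B).Nonempty}
  have hB : B ⊆ ⋃ k ∈ S, dyadicCube ℓ k := fun x hx =>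
    mem_iUnion₂.2 ⟨_, ⟨x, mem_dyadicCube_iff.2 rfl, hx⟩, mem_dyadicCube_iff.2 rfl⟩
  have hS : ⋃ k ∈ S, dyadicCube ℓ k ⊆ Metric.thickening ε.toReal B := by
    refine iUnion₂_subset fun k ⟨y, hyk, hyB⟩ x hx => ?_
    refine Metric.mem_thickening_iff.2 ⟨y, hyB, (dist_le_of_mem_dyadicCube hx hyk).trans_lt ?_⟩
    exact (ENNReal.ofReal_lt_iff_lt_toReal (by positivity) hε_top.ne).1 hε
  calc μ B ≤ μ (⋃ k ∈ S, dyadicCube ℓ k) := measure_mono hB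
    _ ≤ _ := measure_biUnion_dyadicCube_le ℓ μ ν S
    _ ≤ ν (Metric.thickening ε.toReal B) + ε :=
      add_le_add (measure_mono hS) ((ENNReal.ofReal_le_ofReal h).trans hε.le)
end
end

section
/- There exists an absolute constant c > 0 with the following property. For all r, τ > 0 there exists ε₀ > 0 such that for all ρ and ε' with 0 < ρ ≤ ε' ≤ ε₀ the following holds: if η and λ are Borel probability measures on [−1,1]^d and B = B(x,r) is a closed ball such that d_LP(η, λ) < ρ, λ(B(x, r+ρ)) ≤ λ(B(x, r−ρ)) + ε', and min{η(B), λ(B)} ≥ τ, then d_LP(η_B, λ_B) ≤ c·ε'/τ, where for a measure ζ with ζ(B) > 0, ζ_B denotes the normalized restriction ζ(B)⁻¹·ζ|_B. -/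
open MeasureTheory Set Metric

noncomputable section

/-- The normalized restriction `m_B = m(B)⁻¹ · m|_B`. -/
def renormTo {X : Type*} [MeasurableSpace X] (B : Set X) (m : Measure X) : Measure X :=
  (m B)⁻¹ • m.restrict B

theorem thickening_closedBall_subset {X : Type*} [PseudoMetricSpace X] (x : X) (r ρ : ℝ) :
    thickening ρ (closedBall x r) ⊆ closedBall x (r + ρ) := by
  intro y hy
  obtain ⟨z, hz, hyz⟩ := mem_thickening_iff.1 hy
  rw [mem_closedBall] at hz ⊢
  linarith [dist_triangle y z x]

section Renormalization

variable {X : Type*} [MeasurableSpace X]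

theorem isProbabilityMeasure_renormTo {B : Set X} {m : Measure X} [IsFiniteMeasure m]
    (h : m B ≠ 0) : IsProbabilityMeasure (renormTo B m) :=
  ⟨by simp [renormTo, ENNReal.inv_mul_cancel h (measure_ne_top m B)]⟩

theorem renormTo_real_apply (B : Set X) (m : Measure X) {A : Set X} (hA : MeasurableSet A) :
    (renormTo B m).real A = m.real (A ∩ B) / m.real B := by
  simp [renormTo, Measure.real, Measure.restrict_apply hA, ENNReal.toReal_mul,
    ENNReal.toReal_inv, div_eq_inv_mul]

theorem div_le_div_add_of_le_add {a b p q s τ : ℝ} (hτ : 0 < τ) (ha : τ ≤ a) (hb : 0 < b)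
    (hs : 0 ≤ s) (hq : 0 ≤ q) (hqb : q ≤ b) (hpq : p ≤ q + s) (hba : b ≤ a + s) :
    p / a ≤ q / b + 2 * s / τ := by
  have ha0 : 0 < a := hτ.trans_le ha
  have hqb1 : q / b ≤ 1 := (div_le_one hb).2 hqb
  have hqb0 : 0 ≤ q / b := by positivity
  have h1 : p ≤ q / b * a + 2 * s := by
    have h2 : q = q / b * b := by field_simp
    have h3 : q / b * b ≤ q / b * (a + s) := by gcongr
    have h4 : q / b * s ≤ 1 * s := by gcongr
    linarith
  calc p / a ≤ (q / b * a + 2 * s) / a := by gcongr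
    _ = q / b + 2 * s / a := by field_simp
    _ ≤ q / b + 2 * s / τ := by gcongr

theorem measureReal_le_thickening_add [PseudoMetricSpace X] {μ ν : Measure X}
    [IsFiniteMeasure μ] [IsFiniteMeasure ν] {ρ : ℝ} (hρ : 0 ≤ ρ)
    (h : levyProkhorovEDist μ ν < ENNReal.ofReal ρ) {A : Set X}
    (hA : MeasurableSet A) : μ.real A ≤ ν.real (thickening ρ A) + ρ := by
  have h1 := left_measure_le_of_levyProkhorovEDist_lt h hA
  rw [ENNReal.toReal_ofReal hρ] at h1
  have h2 := ENNReal.toReal_mono (by finiteness) h1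
  rwa [ENNReal.toReal_add (by finiteness) (by finiteness), ENNReal.toReal_ofReal hρ] at h2

theorem levyProkhorovEDist_renormTo_le [PseudoMetricSpace X] [OpensMeasurableSpace X]
    {η lam : Measure X} [IsProbabilityMeasure η] [IsProbabilityMeasure lam] {x : X}
    {r τ ρ ε : ℝ} (hτ : 0 < τ) (hρ : 0 < ρ) (hρε : ρ ≤ ε)
    (hd : levyProkhorovEDist η lam < ENNReal.ofReal ρ)
    (hann : lam (closedBall x (r + ρ)) ≤ lam (closedBall x (r - ρ)) + ENNReal.ofReal ε)
    (hη : ENNReal.ofReal τ ≤ η (closedBall x r))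
    (hlam : ENNReal.ofReal τ ≤ lam (closedBall x r)) :
    levyProkhorovEDist (renormTo (closedBall x r) η) (renormTo (closedBall x r) lam) ≤
      ENNReal.ofReal (4 * ε / τ) := by
  have hε : 0 < ε := hρ.trans_le hρε
  have hτ' : 0 < ENNReal.ofReal τ := ENNReal.ofReal_pos.2 hτ
  have := isProbabilityMeasure_renormTo (hτ'.trans_le hη).ne'
  have := isProbabilityMeasure_renormTo (hτ'.trans_le hlam).ne'
  have hηr : τ ≤ η.real (closedBall x r) := (ENNReal.ofReal_le_iff_le_toReal (by finiteness)).1 hη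
  have hlamr : τ ≤ lam.real (closedBall x r) :=
    (ENNReal.ofReal_le_iff_le_toReal (by finiteness)).1 hlam
  have hannr : lam.real (closedBall x (r + ρ)) ≤ lam.real (closedBall x (r - ρ)) + ε := by
    have h := ENNReal.toReal_mono (by finiteness) hann
    rwa [ENNReal.toReal_add (by finiteness) (by finiteness), ENNReal.toReal_ofReal hε.le] at h
  have hτ1 : τ ≤ 1 := hηr.trans measureReal_le_one
  have hρδ : ρ ≤ 4 * ε / τ := by
    rw [le_div_iff₀ hτ]
    nlinarith
  have hsub : lam.real (closedBall x (r - ρ)) ≤ lam.real (closedBall x r) :=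
    measureReal_mono (closedBall_subset_closedBall (by linarith))
  have hba : lam.real (closedBall x r) ≤ η.real (closedBall x r) + 2 * ε := by
    have h1 := measureReal_le_thickening_add hρ.le
      (levyProkhorovEDist_comm η lam ▸ hd) (measurableSet_closedBall (x := x) (ε := r - ρ))
    have h2 : η.real (thickening ρ (closedBall x (r - ρ))) ≤ η.real (closedBall x r) :=
      measureReal_mono (by simpa using thickening_closedBall_subset x (r - ρ) ρ)
    have h3 : lam.real (closedBall x r) ≤ lam.real (closedBall x (r + ρ)) :=
      measureReal_mono (closedBall_subset_closedBall (by linarith))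
    linarith
  refine levyProkhorovEDist_le_of_forall_le _ _ _ fun δ A hδ hδtop hA => ?_
  have hδr : 4 * ε / τ ≤ δ.toReal := (ENNReal.ofReal_le_iff_le_toReal hδtop.ne).1 hδ.le
  set T := thickening δ.toReal A
  have hT : MeasurableSet T := isOpen_thickening.measurableSet
  have hpq : η.real (A ∩ closedBall x r) ≤ lam.real (T ∩ closedBall x r) + 2 * ε := by
    have h1 := measureReal_le_thickening_add hρ.le hd
      (hA.inter (measurableSet_closedBall (x := x) (ε := r)))
    have h2 : thickening ρ (A ∩ closedBall x r) ⊆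
        T ∩ closedBall x r ∪ closedBall x (r + ρ) \ closedBall x r := fun y hy => by
      have hyT : y ∈ T := thickening_mono (hρδ.trans hδr) A
        (thickening_subset_of_subset ρ inter_subset_left hy)
      have hyB := thickening_closedBall_subset x r ρ
        (thickening_subset_of_subset ρ inter_subset_right hy)
      by_cases h : y ∈ closedBall x r
      · exact Or.inl ⟨hyT, h⟩
      · exact Or.inr ⟨hyB, h⟩
    have h3 := (measureReal_mono (μ := lam) h2).trans (measureReal_union_le _ _)
    rw [measureReal_sdiff (closedBall_subset_closedBall (by linarith))
      measurableSet_closedBall] at h3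
    linarith
  have key : (renormTo (closedBall x r) η).real A ≤
      (renormTo (closedBall x r) lam).real T + δ.toReal := by
    rw [renormTo_real_apply _ _ hA, renormTo_real_apply _ _ hT]
    have h := div_le_div_add_of_le_add hτ hηr (hτ.trans_le hlamr) (by positivity)
      measureReal_nonneg (measureReal_mono inter_subset_right) hpq hba
    have h2 : 2 * (2 * ε) / τ = 4 * ε / τ := by ring
    linarith
  rw [← ENNReal.toReal_le_toReal (by finiteness) (by finiteness),
    ENNReal.toReal_add (by finiteness) hδtop.ne]
  exact key

end Renormalization

/-- **Lemma 3.2 (tech2).** There is an absolute constant `c > 0` such that: for all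
`r, τ > 0` and all sufficiently small `ε' ≥ ρ > 0`, if `η, λ` are Borel probability measures
on `[−1,1]^d` with `d_LP(η,λ) < ρ`, if the `λ`-mass of the `ρ`-annulus around the sphere
`∂B(x,r)` is at most `ε'`, and if both `η(B), λ(B) ≥ τ` for `B = B(x,r)`, then
`d_LP(η_B, λ_B) ≤ c ε'/τ`. -/
theorem renorm_levyProkhorov_close {d : ℕ} :
    ∃ c : ℝ, 0 < c ∧
    ∀ r τ : ℝ, 0 < r → 0 < τ →
    ∃ ε₀ : ℝ, 0 < ε₀ ∧
    ∀ ρ ε' : ℝ, 0 < ρ → ρ ≤ ε' → ε' ≤ ε₀ →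
    ∀ (η lam : Measure (EuclideanSpace ℝ (Fin d))) (x : EuclideanSpace ℝ (Fin d)),
      IsProbabilityMeasure η → IsProbabilityMeasure lam →
      η ({y | ∀ j, y j ∈ Icc (-1:ℝ) 1}ᶜ) = 0 → lam ({y | ∀ j, y j ∈ Icc (-1:ℝ) 1}ᶜ) = 0 →
      levyProkhorovEDist η lam < ENNReal.ofReal ρ →
      lam (closedBall x (r + ρ)) ≤ lam (closedBall x (r - ρ)) + ENNReal.ofReal ε' →
      ENNReal.ofReal τ ≤ η (closedBall x r) →
      ENNReal.ofReal τ ≤ lam (closedBall x r) →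
      levyProkhorovEDist (renormTo (closedBall x r) η) (renormTo (closedBall x r) lam) ≤
        ENNReal.ofReal (c * ε' / τ) := by
  refine ⟨4, by norm_num, fun r τ _ hτ => ⟨1, one_pos, ?_⟩⟩
  intro ρ ε' hρ hρε _ η lam x _ _ _ _ hd hann hη hlam
  exact levyProkhorovEDist_renormTo_le hτ hρ hρε hd hann hη hlam
end
end

section
/- Let μ be a Borel probability measure on ℝ × [−1,1] and let π(u,v) = u be the first-coordinate projection. Let μ = ∫ δ_x × μ_x dπ_*μ(x) be the disintegration of μ over π, where (μ_x)_x are Borel probability measures on [−1,1] with μ(A) = ∫ μ_x({v : (x,v) ∈ A}) dπ_*μ(x) for every Borel A. For r > 0 and x with π_*μ([x−2^{−r}, x+2^{−r}]) > 0, let μ^{x,r} be the pushforward of the normalized restriction of μ to the strip [x−2^{−r}, x+2^{−r}] × [−1,1] under the map (u,v) ↦ (2^r·(u−x), v), and let (π_*μ)_{x,r} be the probability measure on [−1,1] given by A ↦ π_*μ(2^{−r}A + x)/π_*μ([x−2^{−r}, x+2^{−r}]). Then for π_*μ-almost every x, d_LP(μ^{x,r}, (π_*μ)_{x,r} × μ_x)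 → 0 as r → ∞. -/
open MeasureTheory Filter Set Metric Topology

noncomputable section

/-- The magnification `μ^{x,r}` of a measure on the strip `[x−2^{−r}, x+2^{−r}] × [−1,1]`:
push the normalized restriction forward under `(u,v) ↦ (2^r (u−x), v)`. -/
def stripMag (μ : Measure (ℝ × ℝ)) (x r : ℝ) : Measure (ℝ × ℝ) :=
  (μ (Icc (x - (2:ℝ) ^ (-r)) (x + (2:ℝ) ^ (-r)) ×ˢ Icc (-1 : ℝ) 1))⁻¹ •
    ((μ.restrict (Icc (x - (2:ℝ) ^ (-r)) (x + (2:ℝ) ^ (-r)) ×ˢ Icc (-1 : ℝ) 1)).map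
      (fun z : ℝ × ℝ => ((2:ℝ) ^ r * (z.1 - x), z.2)))

/-- The magnification `(θ)_{x,r}` of a measure on `ℝ`:
`A ↦ θ(2^{−r}A + x) / θ([x−2^{−r}, x+2^{−r}])`. -/
def intMag (θ : Measure ℝ) (x r : ℝ) : Measure ℝ :=
  (θ (Icc (x - (2:ℝ) ^ (-r)) (x + (2:ℝ) ^ (-r))))⁻¹ •
    ((θ.restrict (Icc (x - (2:ℝ) ^ (-r)) (x + (2:ℝ) ^ (-r)))).map
      (fun u => (2:ℝ) ^ r * (u - x)))

/-- Two functions whose lower Lebesgue integrals add up to the integral of their sum are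
almost everywhere measurable. -/
theorem aemeasurable_of_lintegral_add_le {α : Type*} [MeasurableSpace α] {θ : Measure α}
    {f g : α → ENNReal} (hfin : ∫⁻ a, f a + g a ∂θ ≠ ⊤)
    (hfg : AEMeasurable (fun a => f a + g a) θ)
    (h : ∫⁻ a, f a + g a ∂θ ≤ ∫⁻ a, f a ∂θ + ∫⁻ a, g a ∂θ) : AEMeasurable f θ := by
  obtain ⟨φ, hφ, hφf, hφi⟩ := exists_measurable_le_lintegral_eq θ f
  obtain ⟨ψ, hψ, hψg, hψi⟩ := exists_measurable_le_lintegral_eq θ g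
  have hle : (fun a => φ a + ψ a) ≤ fun a => f a + g a := fun a => add_le_add (hφf a) (hψg a)
  have heq : (fun a => φ a + ψ a) =ᵐ[θ] fun a => f a + g a := by
    refine ae_eq_of_ae_le_of_lintegral_le (.of_forall hle)
      (ne_top_of_le_ne_top hfin (lintegral_mono hle)) hfg ?_
    rwa [lintegral_add_left hφ, ← hφi, ← hψi]
  refine ⟨φ, hφ, ?_⟩
  filter_upwards [heq, ae_lt_top' hfg hfin] with a ha hlt
  refine le_antisymm ?_ (hφf a)
  have hψa : ψ a ≠ ⊤ := ne_top_of_le_ne_top (ENNReal.add_lt_top.1 hlt).2.ne (hψg a)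
  refine (ENNReal.add_le_add_iff_right hψa).1 ?_
  rw [ha]
  exact add_le_add le_rfl (hψg a)

/-- If a measure on a product is concentrated on finitely many thin disjoint strips and is
dominated, up to small errors, by another one on all boxes in these strips, then it is dominated
by the latter on thickenings. -/
theorem measure_le_thickening_add_of_boxes {α β ι : Type*}
    [PseudoMetricSpace α] [PseudoMetricSpace β] [MeasurableSpace α] [MeasurableSpace β]
    [OpensMeasurableSpace α] {s : Finset ι} {G : ι → Set β} {δ : ℝ}
    (hG : ∀ i ∈ s, MeasurableSet (G i)) (hdisj : (s : Set ι).PairwiseDisjoint G)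
    (hdiam : ∀ i ∈ s, ∀ v ∈ G i, ∀ w ∈ G i, dist v w < δ)
    {m m' : Measure (α × β)} (hm : m ((univ : Set α) ×ˢ ⋃ i ∈ s, G i)ᶜ = 0)
    {err : ι → ENNReal}
    (herr : ∀ i ∈ s, ∀ B : Set α, MeasurableSet B → m (B ×ˢ G i) ≤ m' (B ×ˢ G i) + err i)
    (A : Set (α × β)) :
    m A ≤ m' (thickening δ A) + ∑ i ∈ s, err i := by
  set B : ι → Set α := fun i => thickening δ (Prod.fst '' (A ∩ (univ ×ˢ G i)))
  have hBm : ∀ i, MeasurableSet (B i) := fun i => isOpen_thickening.measurableSet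
  have hcover : A ⊆ (⋃ i ∈ s, B i ×ˢ G i) ∪ ((univ : Set α) ×ˢ ⋃ i ∈ s, G i)ᶜ := by
    rintro ⟨u, v⟩ hA
    by_cases hv : v ∈ ⋃ i ∈ s, G i
    · left
      obtain ⟨i, hi, hvi⟩ := mem_iUnion₂.1 hv
      have hδ : 0 < δ := dist_nonneg.trans_lt (hdiam i hi v hvi v hvi)
      exact mem_iUnion₂.2 ⟨i, hi, self_subset_thickening hδ _ ⟨(u, v), ⟨hA, trivial, hvi⟩, rfl⟩, hvi⟩
    · right
      exact fun h => hv h.2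
  have hsub : (⋃ i ∈ s, B i ×ˢ G i) ⊆ thickening δ A := by
    rintro ⟨u, v⟩ h
    obtain ⟨i, hi, hu, hv⟩ := mem_iUnion₂.1 h
    obtain ⟨_, ⟨⟨u', v'⟩, ⟨hA, -, hv'⟩, rfl⟩, hd⟩ := mem_thickening_iff.1 hu
    exact mem_thickening_iff.2 ⟨(u', v'), hA, max_lt hd (hdiam i hi v hv v' hv')⟩
  have hdisj' : (s : Set ι).PairwiseDisjoint fun i => B i ×ˢ G i := fun i hi j hj hij =>
    Set.disjoint_prod.2 (Or.inr (hdisj hi hj hij))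
  calc m A ≤ m (⋃ i ∈ s, B i ×ˢ G i) + m ((univ : Set α) ×ˢ ⋃ i ∈ s, G i)ᶜ :=
        (measure_mono hcover).trans (measure_union_le _ _)
    _ ≤ ∑ i ∈ s, m (B i ×ˢ G i) := by
        rw [hm, add_zero]; exact measure_biUnion_finset_le _ _
    _ ≤ ∑ i ∈ s, (m' (B i ×ˢ G i) + err i) := Finset.sum_le_sum fun i hi => herr i hi _ (hBm i)
    _ = m' (⋃ i ∈ s, B i ×ˢ G i) + ∑ i ∈ s, err i := by
        rw [Finset.sum_add_distrib, measure_biUnion_finset hdisj' fun i hi => (hBm i).prod (hG i hi)]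
    _ ≤ m' (thickening δ A) + ∑ i ∈ s, err i := by gcongr

/-- The `k`-th interval of length `1 / (n + 1)`. -/
def gridIco (n : ℕ) (k : ℤ) : Set ℝ := {v | ⌊((n : ℝ) + 1) * v⌋ = k}

theorem measurableSet_gridIco (n : ℕ) (k : ℤ) : MeasurableSet (gridIco n k) :=
  (Int.measurable_floor.comp (measurable_const_mul _)) (measurableSet_singleton k)

theorem pairwiseDisjoint_gridIco (n : ℕ) (s : Set ℤ) : s.PairwiseDisjoint (gridIco n) :=
  fun _ _ _ _ hij => Set.disjoint_left.2 fun _ hv hv' => hij (hv.symm.trans hv')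

theorem dist_lt_of_mem_gridIco {n : ℕ} {k : ℤ} {v w : ℝ} (hv : v ∈ gridIco n k)
    (hw : w ∈ gridIco n k) : dist v w < 1 / ((n : ℝ) + 1) := by
  have hn : (0 : ℝ) < (n : ℝ) + 1 := by positivity
  have h := Int.abs_sub_lt_one_of_floor_eq_floor
    ((show ⌊((n : ℝ) + 1) * v⌋ = k from hv).trans (show ⌊((n : ℝ) + 1) * w⌋ = k from hw).symm)
  rw [← mul_sub, abs_mul, abs_of_pos hn] at h
  rw [Real.dist_eq, lt_div_iff₀ hn, mul_comm]
  exact h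

theorem Icc_subset_iUnion_gridIco (n : ℕ) :
    Icc (-1 : ℝ) 1 ⊆ ⋃ k ∈ Finset.Icc (-(n + 1 : ℤ)) (n + 1 : ℤ), gridIco n k := by
  intro v hv
  have hn : (0 : ℝ) < (n : ℝ) + 1 := by positivity
  refine mem_iUnion₂.2 ⟨⌊((n : ℝ) + 1) * v⌋, Finset.mem_Icc.2 ⟨?_, ?_⟩, rfl⟩
  · rw [Int.le_floor]; push_cast; nlinarith [hv.1]
  · rw [← Int.cast_le (R := ℝ)]; refine (Int.floor_le _).trans ?_; push_cast; nlinarith [hv.2]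

section Magnification

variable {μ : Measure (ℝ × ℝ)} {μx : ℝ → Measure ℝ}

theorem measure_prod_eq_setLIntegral
    (hdis : ∀ A : Set (ℝ × ℝ), MeasurableSet A →
      μ A = ∫⁻ x, (μx x) {v : ℝ | (x, v) ∈ A} ∂(μ.map Prod.fst))
    {B C : Set ℝ} (hB : MeasurableSet B) (hC : MeasurableSet C) :
    μ (B ×ˢ C) = ∫⁻ x in B, μx x C ∂(μ.map Prod.fst) := by
  rw [hdis _ (hB.prod hC), ← lintegral_indicator hB]
  congr 1 with x
  by_cases hx : x ∈ B <;> simp [hx]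

theorem aemeasurable_disintegration [IsProbabilityMeasure μ]
    (hprob : ∀ x, IsProbabilityMeasure (μx x))
    (hdis : ∀ A : Set (ℝ × ℝ), MeasurableSet A →
      μ A = ∫⁻ x, (μx x) {v : ℝ | (x, v) ∈ A} ∂(μ.map Prod.fst))
    {C : Set ℝ} (hC : MeasurableSet C) :
    AEMeasurable (fun x => μx x C) (μ.map Prod.fst) := by
  have := Measure.isProbabilityMeasure_map (μ := μ) measurable_fst.aemeasurable
  have hsum : ∀ x, μx x C + μx x Cᶜ = 1 := fun x => prob_add_prob_compl hC
  have h1 := measure_prod_eq_setLIntegral hdis MeasurableSet.univ hC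
  have h2 := measure_prod_eq_setLIntegral hdis MeasurableSet.univ hC.compl
  rw [setLIntegral_univ] at h1 h2
  refine aemeasurable_of_lintegral_add_le (g := fun x => μx x Cᶜ) ?_ ?_ ?_
  · simp [hsum]
  · simp [hsum]
  · simp_rw [hsum, ← h1, ← h2]
    rw [univ_prod, univ_prod, preimage_compl, prob_add_prob_compl (measurable_snd hC)]
    simp

theorem measure_prod_Icc (hsupp : μ ((univ : Set ℝ) ×ˢ Icc (-1 : ℝ) 1)ᶜ = 0)
    {B C : Set ℝ} : μ (B ×ˢ (C ∩ Icc (-1 : ℝ) 1)) = μ (B ×ˢ C) := by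
  rw [← measure_inter_conull (s := B ×ˢ C) (t := (univ : Set ℝ) ×ˢ Icc (-1 : ℝ) 1), prod_inter_prod,
    inter_univ]
  exact hsupp

theorem stripMag_compl (x r : ℝ) :
    stripMag μ x r ((univ : Set ℝ) ×ˢ Icc (-1 : ℝ) 1)ᶜ = 0 := by
  have hm : MeasurableSet ((univ : Set ℝ) ×ˢ Icc (-1 : ℝ) 1) := .prod .univ measurableSet_Icc
  rw [stripMag, Measure.smul_apply, Measure.map_apply (by fun_prop) hm.compl,
    Measure.restrict_apply (hm.compl.preimage (by fun_prop))]
  suffices h : (fun z : ℝ × ℝ => ((2:ℝ) ^ r * (z.1 - x), z.2)) ⁻¹'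
      ((univ : Set ℝ) ×ˢ Icc (-1 : ℝ) 1)ᶜ ∩
      Icc (x - (2:ℝ) ^ (-r)) (x + (2:ℝ) ^ (-r)) ×ˢ Icc (-1 : ℝ) 1 = ∅ by
    rw [h, measure_empty, smul_zero]
  ext z
  simp only [mem_inter_iff, mem_preimage, mem_compl_iff, mem_prod, mem_univ, true_and,
    mem_empty_iff_false, iff_false]
  tauto

theorem stripMag_prod (hsupp : μ ((univ : Set ℝ) ×ˢ Icc (-1 : ℝ) 1)ᶜ = 0)
    (hdis : ∀ A : Set (ℝ × ℝ), MeasurableSet A →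
      μ A = ∫⁻ x, (μx x) {v : ℝ | (x, v) ∈ A} ∂(μ.map Prod.fst))
    (x r : ℝ) {B C : Set ℝ} (hB : MeasurableSet B) (hC : MeasurableSet C) :
    stripMag μ x r (B ×ˢ C) =
      (∫⁻ u in (fun u => (2:ℝ) ^ r * (u - x)) ⁻¹' B ∩ closedBall x ((2:ℝ) ^ (-r)),
        μx u C ∂(μ.map Prod.fst)) / μ.map Prod.fst (closedBall x ((2:ℝ) ^ (-r))) := by
  have hT : Measurable (fun u => (2:ℝ) ^ r * (u - x)) := by fun_prop
  have hpre : (fun z : ℝ × ℝ => ((2:ℝ) ^ r * (z.1 - x), z.2)) ⁻¹' (B ×ˢ C) =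
      ((fun u => (2:ℝ) ^ r * (u - x)) ⁻¹' B) ×ˢ C := rfl
  rw [stripMag, Measure.smul_apply, Measure.map_apply (by fun_prop) (hB.prod hC), hpre,
    Measure.restrict_apply ((hT hB).prod hC), prod_inter_prod, measure_prod_Icc hsupp,
    ← univ_inter (Icc (-1 : ℝ) 1), measure_prod_Icc hsupp, ← Real.closedBall_eq_Icc,
    measure_prod_eq_setLIntegral hdis ((hT hB).inter measurableSet_closedBall) hC,
    Measure.map_apply measurable_fst measurableSet_closedBall, prod_univ, smul_eq_mul,
    ENNReal.div_eq_inv_mul]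

theorem intMag_apply (θ : Measure ℝ) (x r : ℝ) {B : Set ℝ} (hB : MeasurableSet B) :
    intMag θ x r B = θ ((fun u => (2:ℝ) ^ r * (u - x)) ⁻¹' B ∩ closedBall x ((2:ℝ) ^ (-r))) /
      θ (closedBall x ((2:ℝ) ^ (-r))) := by
  have hT : Measurable (fun u => (2:ℝ) ^ r * (u - x)) := by fun_prop
  rw [intMag, Measure.smul_apply, Measure.map_apply hT hB, Measure.restrict_apply (hT hB),
    ← Real.closedBall_eq_Icc, smul_eq_mul, ENNReal.div_eq_inv_mul]

end Magnification

theorem ENNReal.le_add_enorm_toReal_sub {a b : ENNReal} (ha : a ≠ ⊤) (hb : b ≠ ⊤) :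
    a ≤ b + ‖a.toReal - b.toReal‖ₑ := by
  rw [← ENNReal.ofReal_toReal ha, ← ENNReal.ofReal_toReal hb, Real.enorm_eq_ofReal_abs,
    ENNReal.toReal_ofReal toReal_nonneg, ENNReal.toReal_ofReal toReal_nonneg,
    ← ENNReal.ofReal_add toReal_nonneg (abs_nonneg _)]
  exact ENNReal.ofReal_le_ofReal (by linarith [le_abs_self (a.toReal - b.toReal)])

/-- On any set, the integral of a finite function and the integral of a constant differ by at most
the integral of the distance. -/
theorem setLIntegral_le_and_le_of_subset {α : Type*} [MeasurableSpace α] {θ : Measure α}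
    {f : α → ENNReal} {c : ENNReal} (hf : ∀ a, f a ≠ ⊤) (hc : c ≠ ⊤) (hfm : AEMeasurable f θ)
    {s t : Set α} (hst : s ⊆ t) :
    ∫⁻ a in s, f a ∂θ ≤ θ s * c + ∫⁻ a in t, ‖(f a).toReal - c.toReal‖ₑ ∂θ ∧
    θ s * c ≤ ∫⁻ a in s, f a ∂θ + ∫⁻ a in t, ‖(f a).toReal - c.toReal‖ₑ ∂θ := by
  have hmono : ∫⁻ a in s, ‖(f a).toReal - c.toReal‖ₑ ∂θ ≤
      ∫⁻ a in t, ‖(f a).toReal - c.toReal‖ₑ ∂θ := lintegral_mono_set hst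
  have hconst : θ s * c = ∫⁻ _ in s, c ∂θ := by rw [setLIntegral_const, mul_comm]
  rw [hconst]
  constructor
  · refine le_trans ?_ (add_le_add le_rfl hmono)
    rw [← lintegral_add_left measurable_const]
    exact lintegral_mono fun a => ENNReal.le_add_enorm_toReal_sub (hf a) hc
  · refine le_trans ?_ (add_le_add le_rfl hmono)
    rw [← lintegral_add_left' hfm.restrict]
    refine lintegral_mono fun a => ?_
    rw [← enorm_neg, neg_sub]
    exact ENNReal.le_add_enorm_toReal_sub hc (hf a)

/-- **Lemma 6.2 (product structure of magnifications along strips).** For a probability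
measure `μ` on `ℝ × [−1,1]` with disintegration `μ = ∫ δ_x × μ_x dπ_*μ(x)` over the first
coordinate projection `π`, the magnifications of `μ` along vertical strips are asymptotic to
`(π_*μ)_{x,r} × μ_x`. Here `ℝ²` carries the maximum metric. -/
theorem strip_magnification_product_structure
    (μ : Measure (ℝ × ℝ)) [IsProbabilityMeasure μ]
    (hsupp : μ ((univ : Set ℝ) ×ˢ Icc (-1 : ℝ) 1)ᶜ = 0)
    (μx : ℝ → Measure ℝ)
    (hprob : ∀ x, IsProbabilityMeasure (μx x))
    (hxsupp : ∀ x, (μx x) (Icc (-1 : ℝ) 1)ᶜ = 0)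
    (hdis : ∀ A : Set (ℝ × ℝ), MeasurableSet A →
      μ A = ∫⁻ x, (μx x) {v : ℝ | (x, v) ∈ A} ∂(μ.map Prod.fst)) :
    ∀ᵐ x ∂(μ.map Prod.fst),
      Tendsto (fun r : ℝ =>
          levyProkhorovEDist (stripMag μ x r) ((intMag (μ.map Prod.fst) x r).prod (μx x)))
        atTop (𝓝 0) := by
  have := Measure.isProbabilityMeasure_map (μ := μ) measurable_fst.aemeasurable
  set θ := μ.map Prod.fst
  have hmeas : ∀ n k, AEMeasurable (fun u => μx u (gridIco n k)) θ := fun n k =>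
    aemeasurable_disintegration hprob hdis (measurableSet_gridIco n k)
  have hfin : ∀ n k u, μx u (gridIco n k) ≠ ⊤ := fun n k u => measure_ne_top _ _
  have hint : ∀ n k, Integrable (fun u => (μx u (gridIco n k)).toReal) θ := fun n k =>
    Integrable.of_bound (hmeas n k).ennreal_toReal.aestronglyMeasurable 1 <| .of_forall fun u => by
      rw [Real.norm_of_nonneg ENNReal.toReal_nonneg]
      exact ENNReal.toReal_le_of_le_ofReal zero_le_one (by simpa using prob_le_one)
  have hleb : ∀ᵐ x ∂θ, ∀ p : ℕ × ℤ, Tendsto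
      (fun a => (∫⁻ u in a, ‖(μx u (gridIco p.1 p.2)).toReal -
        (μx x (gridIco p.1 p.2)).toReal‖ₑ ∂θ) / θ a)
      ((Besicovitch.vitaliFamily θ).filterAt x) (𝓝 0) := ae_all_iff.2 fun p =>
    (Besicovitch.vitaliFamily θ).ae_tendsto_lintegral_enorm_sub_div_of_integrable (hint p.1 p.2)
  have hrad : Tendsto (fun r : ℝ => (2:ℝ) ^ (-r)) atTop (𝓝[>] 0) :=
    tendsto_nhdsWithin_iff.2 ⟨(tendsto_rpow_atBot_of_base_gt_one 2 one_lt_two).comp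
      tendsto_neg_atTop_atBot, .of_forall fun r => Real.rpow_pos_of_pos two_pos _⟩
  filter_upwards [hleb] with x hx
  set err : ℕ → ℤ → ℝ → ENNReal := fun n k r =>
    (∫⁻ u in closedBall x ((2:ℝ) ^ (-r)), ‖(μx u (gridIco n k)).toReal -
        (μx x (gridIco n k)).toReal‖ₑ ∂θ) / θ (closedBall x ((2:ℝ) ^ (-r)))
  have herr_tendsto : ∀ n k, Tendsto (err n k) atTop (𝓝 0) := fun n k =>
    (hx (n, k)).comp ((Besicovitch.tendsto_filterAt θ x).comp hrad)
  have hbox : ∀ n k r (B : Set ℝ), MeasurableSet B →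
      stripMag μ x r (B ×ˢ gridIco n k) ≤
        (intMag θ x r).prod (μx x) (B ×ˢ gridIco n k) + err n k r ∧
      (intMag θ x r).prod (μx x) (B ×ˢ gridIco n k) ≤
        stripMag μ x r (B ×ˢ gridIco n k) + err n k r := by
    intro n k r B hB
    obtain ⟨h1, h2⟩ := setLIntegral_le_and_le_of_subset (hfin n k) (hfin n k x) (hmeas n k)
      (inter_subset_right (s := (fun u => (2:ℝ) ^ r * (u - x)) ⁻¹' B)
        (t := closedBall x ((2:ℝ) ^ (-r))))
    rw [stripMag_prod hsupp hdis x r hB (measurableSet_gridIco n k), Measure.prod_prod,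
      intMag_apply θ x r hB, ENNReal.mul_comm_div, ← mul_div_assoc, ← ENNReal.add_div,
      ← ENNReal.add_div]
    exact ⟨ENNReal.div_le_div_right h1 _, ENNReal.div_le_div_right h2 _⟩
  have hcompl : ∀ (n : ℕ) (m : Measure (ℝ × ℝ)), m ((univ : Set ℝ) ×ˢ Icc (-1 : ℝ) 1)ᶜ = 0 →
      m ((univ : Set ℝ) ×ˢ ⋃ k ∈ Finset.Icc (-(n + 1 : ℤ)) (n + 1 : ℤ), gridIco n k)ᶜ = 0 :=
    fun n m hm => measure_mono_null
      (compl_subset_compl.2 (prod_mono le_rfl (Icc_subset_iUnion_gridIco n))) hm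
  have hprodcompl : ∀ r, (intMag θ x r).prod (μx x) ((univ : Set ℝ) ×ˢ Icc (-1 : ℝ) 1)ᶜ = 0 := by
    intro r
    rw [univ_prod, ← preimage_compl, ← univ_prod, Measure.prod_prod, hxsupp, mul_zero]
  refine ENNReal.tendsto_nhds_zero.2 fun ε hε => ?_
  obtain ⟨ε', hε', hε'ε⟩ := exists_between hε
  have hε't : ε' ≠ ⊤ := hε'ε.ne_top
  obtain ⟨n, hn⟩ := exists_nat_one_div_lt (ENNReal.toReal_pos hε'.ne' hε't)
  have hsum : Tendsto (fun r => ∑ k ∈ Finset.Icc (-(n + 1 : ℤ)) (n + 1 : ℤ), err n k r) atTop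
      (𝓝 0) := by
    simpa using tendsto_finsetSum (Finset.Icc (-(n + 1 : ℤ)) (n + 1 : ℤ))
      fun k _ => herr_tendsto n k
  filter_upwards [ENNReal.tendsto_nhds_zero.1 hsum ε' hε'] with r hr
  refine le_trans (levyProkhorovEDist_le_of_forall _ _ ε' fun δ A hδ hδt _ => ?_) hε'ε.le
  have hdiam : ∀ k ∈ Finset.Icc (-(n + 1 : ℤ)) (n + 1 : ℤ), ∀ v ∈ gridIco n k, ∀ w ∈ gridIco n k,
      dist v w < δ.toReal := fun k _ v hv w hw =>
    (dist_lt_of_mem_gridIco hv hw).trans (hn.trans ((ENNReal.toReal_lt_toReal hε't hδt.ne).2 hδ))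
  constructor
  · exact (measure_le_thickening_add_of_boxes (fun k _ => measurableSet_gridIco n k)
      (pairwiseDisjoint_gridIco n _) hdiam (hcompl n _ (stripMag_compl x r))
      (fun k _ B hB => (hbox n k r B hB).1) A).trans (add_le_add le_rfl (hr.trans hδ.le))
  · exact (measure_le_thickening_add_of_boxes (fun k _ => measurableSet_gridIco n k)
      (pairwiseDisjoint_gridIco n _) hdiam (hcompl n _ (hprodcompl r))
      (fun k _ B hB => (hbox n k r B hB).2) A).trans (add_le_add le_rfl (hr.trans hδ.le))
end
end
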